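/- (Existence and uniqueness of the optimal action-value function, the fixed point targeted by the RMAQ algorithm.) In an MG-SPA, there exists a unique q* : S → A → B → ℝ satisfying T q* = q*, i.e. q*(s, a, b) = r s a b + γ · ∑_{s' ∈ S} p s a b s' · Val (q* s') for all s ∈ S, a ∈ A, b ∈ B. -/

import Mathlib

open scoped BigOperators

section MGSPA

variable {S A B : Type*}

/-- The value of the matrix game in behavioral strategies: the adversary moves
first with a mixed action `y ∈ stdSimplex ℝ B`, the agent responds with a plan
`x : B → stdSimplex ℝ A`. -/
noncomputable def matrixGameVal [Fintype A] [Fintype B]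
    (M : A → B → ℝ) : ℝ :=
  ⨆ x : B → stdSimplex ℝ A, ⨅ y : stdSimplex ℝ B,
    ∑ b, (y : B → ℝ) b * ∑ a, (x b : A → ℝ) a * M a b

/-- The Q-function Bellman operator of the MG-SPA:
`(T q)(s, a, b) = r s a b + γ * ∑ s', p s a b s' * Val (q s')`. -/
noncomputable def Tq [Fintype S] [Fintype A] [Fintype B]
    (γ : ℝ) (r : S → A → B → ℝ) (p : S → A → B → S → ℝ)
    (q : S → A → B → ℝ) : S → A → B → ℝ :=
  fun s a b => r s a b + γ * ∑ s', p s a b s' * matrixGameVal (q s')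

/-- The minimax (Shapley) Bellman operator of the MG-SPA. -/
noncomputable def Lop [Fintype S] [Fintype A] [Fintype B]
    (γ : ℝ) (r : S → A → B → ℝ) (p : S → A → B → S → ℝ)
    (v : S → ℝ) : S → ℝ :=
  fun s => ⨆ x : B → stdSimplex ℝ A, ⨅ y : stdSimplex ℝ B,
    ∑ b, (y : B → ℝ) b * ∑ a, (x b : A → ℝ) a *
      (r s a b + γ * ∑ s', p s a b s' * v s')

end MGSPA

section MGSPA

variable {S A B : Type*}

theorem sum_mul_le_add_of_mem_stdSimplex {X : Type*} [Fintype X] {w f g : X → ℝ} {c : ℝ}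
    (hw : w ∈ stdSimplex ℝ X) (h : ∀ i, f i ≤ g i + c) :
    ∑ i, w i * f i ≤ ∑ i, w i * g i + c := by
  calc ∑ i, w i * f i ≤ ∑ i, w i * (g i + c) :=
        Finset.sum_le_sum fun i _ => mul_le_mul_of_nonneg_left (h i) (hw.1 i)
    _ = ∑ i, w i * g i + c := by
        simp only [mul_add, Finset.sum_add_distrib, ← Finset.sum_mul, hw.2, one_mul]

theorem payoff_le_payoff_add [Fintype A] [Fintype B] {M N : A → B → ℝ} {c : ℝ}
    (h : ∀ a b, M a b ≤ N a b + c) (x : B → stdSimplex ℝ A) (y : stdSimplex ℝ B) :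
    ∑ b, (y : B → ℝ) b * ∑ a, (x b : A → ℝ) a * M a b ≤
      ∑ b, (y : B → ℝ) b * ∑ a, (x b : A → ℝ) a * N a b + c :=
  sum_mul_le_add_of_mem_stdSimplex y.2 fun b =>
    sum_mul_le_add_of_mem_stdSimplex (x b).2 fun a => h a b

theorem abs_apply_sub_apply_le_dist [Fintype A] [Fintype B] (M N : A → B → ℝ) (a : A) (b : B) :
    |M a b - N a b| ≤ dist M N :=
  (dist_le_pi_dist (M a) (N a) b).trans (dist_le_pi_dist M N a)

theorem abs_payoff_le [Fintype A] [Fintype B] (M : A → B → ℝ)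
    (x : B → stdSimplex ℝ A) (y : stdSimplex ℝ B) :
    |∑ b, (y : B → ℝ) b * ∑ a, (x b : A → ℝ) a * M a b| ≤ dist M 0 := by
  have hM : ∀ a b, |M a b| ≤ dist M 0 := fun a b => by
    simpa using abs_apply_sub_apply_le_dist M 0 a b
  have upper := payoff_le_payoff_add (M := M) (N := 0) (c := dist M 0)
    (fun a b => by simpa using (abs_le.1 (hM a b)).2) x y
  have lower := payoff_le_payoff_add (M := 0) (N := M) (c := dist M 0)
    (fun a b => by
      rw [Pi.zero_apply, Pi.zero_apply]
      linarith [(abs_le.1 (hM a b)).1]) x y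
  simp only [Pi.zero_apply, mul_zero, Finset.sum_const_zero] at upper lower
  exact abs_le.2 ⟨by linarith, by linarith⟩

theorem matrixGameVal_le_add [Fintype A] [Nonempty A] [Fintype B] [Nonempty B]
    {M N : A → B → ℝ} {c : ℝ} (h : ∀ a b, M a b ≤ N a b + c) :
    matrixGameVal M ≤ matrixGameVal N + c := by
  have bddBelow (K : A → B → ℝ) (x : B → stdSimplex ℝ A) :
      BddBelow (Set.range fun y : stdSimplex ℝ B =>
        ∑ b, (y : B → ℝ) b * ∑ a, (x b : A → ℝ) a * K a b) :=
    ⟨-dist K 0, by rintro _ ⟨y, rfl⟩; exact (abs_le.1 (abs_payoff_le K x y)).1⟩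
  have bddAbove : BddAbove (Set.range fun x : B → stdSimplex ℝ A => ⨅ y : stdSimplex ℝ B,
      ∑ b, (y : B → ℝ) b * ∑ a, (x b : A → ℝ) a * N a b) := by
    refine ⟨dist N 0, ?_⟩
    rintro _ ⟨x, rfl⟩
    obtain ⟨y⟩ : Nonempty (stdSimplex ℝ B) := inferInstance
    exact (ciInf_le (bddBelow N x) y).trans (abs_le.1 (abs_payoff_le N x y)).2
  refine ciSup_le fun x => ?_
  refine le_trans ?_ (add_le_add_left (le_ciSup bddAbove x) c)
  rw [← sub_le_iff_le_add]
  refine le_ciInf fun y => ?_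
  rw [sub_le_iff_le_add]
  exact (ciInf_le (bddBelow M x) y).trans (payoff_le_payoff_add h x y)

theorem abs_matrixGameVal_sub_le_dist [Fintype A] [Nonempty A] [Fintype B] [Nonempty B]
    (M N : A → B → ℝ) : |matrixGameVal M - matrixGameVal N| ≤ dist M N := by
  have h := abs_apply_sub_apply_le_dist M N
  have h₁ : matrixGameVal M ≤ matrixGameVal N + dist M N :=
    matrixGameVal_le_add fun a b => by linarith [(abs_le.1 (h a b)).2]
  have h₂ : matrixGameVal N ≤ matrixGameVal M + dist M N :=
    matrixGameVal_le_add fun a b => by linarith [(abs_le.1 (h a b)).1]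
  exact abs_le.2 ⟨by linarith, by linarith⟩

theorem dist_Tq_le [Fintype S] [Fintype A] [Nonempty A] [Fintype B] [Nonempty B]
    {γ : ℝ} (hγ0 : 0 ≤ γ) (r : S → A → B → ℝ) {p : S → A → B → S → ℝ}
    (hp : ∀ s a b, p s a b ∈ stdSimplex ℝ S) (q q' : S → A → B → ℝ) :
    dist (Tq γ r p q) (Tq γ r p q') ≤ γ * dist q q' := by
  have hc : 0 ≤ γ * dist q q' := mul_nonneg hγ0 dist_nonneg
  refine (dist_pi_le_iff hc).2 fun s => (dist_pi_le_iff hc).2 fun a =>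
    (dist_pi_le_iff hc).2 fun b => ?_
  have h (s' : S) : |matrixGameVal (q s') - matrixGameVal (q' s')| ≤ dist q q' :=
    (abs_matrixGameVal_sub_le_dist _ _).trans (dist_le_pi_dist q q' s')
  have h₁ := sum_mul_le_add_of_mem_stdSimplex (hp s a b)
    (f := fun s' => matrixGameVal (q s')) (g := fun s' => matrixGameVal (q' s'))
    (c := dist q q') fun s' => by linarith [(abs_le.1 (h s')).2]
  have h₂ := sum_mul_le_add_of_mem_stdSimplex (hp s a b)
    (f := fun s' => matrixGameVal (q' s')) (g := fun s' => matrixGameVal (q s'))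
    (c := dist q q') fun s' => by linarith [(abs_le.1 (h s')).1]
  rw [Real.dist_eq, Tq, Tq, add_sub_add_left_eq_sub, ← mul_sub, abs_mul, abs_of_nonneg hγ0]
  exact mul_le_mul_of_nonneg_left (abs_le.2 ⟨by linarith, by linarith⟩) hγ0

end MGSPA

/-- (Existence and uniqueness of the optimal action-value function, the fixed
point targeted by the RMAQ algorithm.)  There is a unique
`q* : S → A → B → ℝ` with `T q* = q*`. -/
theorem optimal_Q_exists_unique
    {S A B : Type*} [Fintype S] [Nonempty S]
    [Fintype A] [Nonempty A] [Fintype B] [Nonempty B]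
    (γ : ℝ) (hγ0 : 0 ≤ γ) (hγ1 : γ < 1)
    (r : S → A → B → ℝ) (p : S → A → B → S → ℝ)
    (hp0 : ∀ s a b s', 0 ≤ p s a b s')
    (hp1 : ∀ s a b, ∑ s', p s a b s' = 1) :
    ∃! q : S → A → B → ℝ, Tq γ r p q = q := by
  have hT : ContractingWith ⟨γ, hγ0⟩ (Tq γ r p) :=
    ⟨hγ1, LipschitzWith.of_dist_le_mul
      (dist_Tq_le hγ0 r fun s a b => ⟨hp0 s a b, hp1 s a b⟩)⟩
  exact ⟨hT.fixedPoint, hT.fixedPoint_isFixedPt, fun _ hq => hT.fixedPoint_unique hq⟩
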